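/- Let n ≥ 1 and let c, d : ℤⁿ → ℝ be square-summable families (Σ_{k∈ℤⁿ} (c_k² + d_k²) < ∞). For t > 0 define f_t : ℝⁿ → ℝ by f_t(x) = Σ_{k∈ℤⁿ} e^{−|k|² t} (c_k cos(k·x) + d_k sin(k·x)). For i = 1,…,n set a_i = c_{e_i} + c_{−e_i} and b_i = d_{e_i} − d_{−e_i}, where e_i is the i-th standard basis vector of ℤⁿ. If a_i² + b_i² ≠ 0 for every i = 1,…,n, then there exists T > 0 such that for every t ≥ T the function f_t has exactly 2ⁿ critical points in [0,2π)ⁿ and every critical point of f_t is nondegenerate (its Hessian is invertible). -/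

import Mathlib

open Real

theorem abs_arcsin_sub_arcsin_le {u v : ℝ} (hu : |u| ≤ 1 / 2) (hv : |v| ≤ 1 / 2) :
    |arcsin u - arcsin v| ≤ 2 * |u - v| := by
  have key := Convex.norm_image_sub_le_of_norm_hasDerivWithin_le (f := arcsin)
    (f' := fun x => 1 / √(1 - x ^ 2)) (s := Set.Icc (-(1 / 2) : ℝ) (1 / 2)) (C := 2)
    (x := v) (y := u)
    (fun x hx => (Real.hasDerivAt_arcsin (by linarith [hx.1]) (by linarith [hx.2])).hasDerivWithinAt)
    (fun x hx => ?_) (convex_Icc _ _) (abs_le.1 hv) (abs_le.1 hu)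
  · simpa only [Real.norm_eq_abs] using key
  · have h : (1 / 2 : ℝ) ≤ √(1 - x ^ 2) := Real.le_sqrt_of_sq_le (by nlinarith [hx.1, hx.2])
    rw [Real.norm_eq_abs, abs_of_nonneg (by positivity), div_le_iff₀ (by linarith)]
    linarith

theorem half_le_abs_cos {y : ℝ} (h : |sin y| ≤ 1 / 2) : 1 / 2 ≤ |cos y| := by
  have h2 : (1 / 2 : ℝ) ^ 2 ≤ |cos y| ^ 2 := by
    rw [sq_abs]
    nlinarith [sin_sq_add_cos_sq y, abs_le.1 h]
  exact le_of_sq_le_sq h2 (abs_nonneg _)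

/-- The two branches of the inverse sine modulo `2π`. -/
noncomputable def arcsinBranch (s : Bool) (r : ℝ) : ℝ := if s then π - arcsin r else arcsin r

theorem sin_arcsinBranch (s : Bool) {r : ℝ} (hr : |r| ≤ 1 / 2) : sin (arcsinBranch s r) = r := by
  have h := abs_le.1 hr
  cases s <;> simp [arcsinBranch, Real.sin_arcsin (by linarith : -1 ≤ r) (by linarith)]

theorem cos_arcsinBranch_pos_iff (s : Bool) {r : ℝ} (hr : |r| ≤ 1 / 2) :
    0 < cos (arcsinBranch s r) ↔ s = false := by
  have h := abs_le.1 hr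
  have : 0 < √(1 - r ^ 2) := Real.sqrt_pos.2 (by nlinarith)
  cases s
  · simpa [arcsinBranch, Real.cos_arcsin] using this
  · simp [arcsinBranch, Real.cos_arcsin]

theorem abs_arcsinBranch_sub_le (s : Bool) {u v : ℝ} (hu : |u| ≤ 1 / 2) (hv : |v| ≤ 1 / 2) :
    |arcsinBranch s u - arcsinBranch s v| ≤ 2 * |u - v| := by
  have h := abs_arcsin_sub_arcsin_le hu hv
  cases s
  · simpa [arcsinBranch] using h
  · simpa [arcsinBranch, abs_sub_comm] using h

theorem exists_eq_arcsinBranch {y r : ℝ} (hr : |r| ≤ 1 / 2) (h : sin y = r) :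
    ∃ (s : Bool) (m : ℤ), y - m * (2 * π) = arcsinBranch s r := by
  have h' := abs_le.1 hr
  rw [← Real.sin_arcsin (by linarith : -1 ≤ r) (by linarith), eq_comm, Real.sin_eq_sin_iff] at h
  obtain ⟨k, h | h⟩ := h
  · exact ⟨false, k, by simp only [arcsinBranch, Bool.false_eq_true, if_false]; linarith⟩
  · exact ⟨true, k, by simp only [arcsinBranch, if_true]; linarith⟩

/-- A small `2π`-periodic perturbation `sin (x i - φ i) = ρ i x` of a decoupled system of sine
equations has exactly `2 ^ n` solutions modulo `2π`. -/
theorem ncard_sin_sub_eq_perturbation {n : ℕ} (φ : Fin n → ℝ) (ρ : Fin n → (Fin n → ℝ) → ℝ)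
    (hρ : ∀ i x, |ρ i x| ≤ 1 / 2) (hlip : ∀ i x y, |ρ i x - ρ i y| ≤ 1 / 4 * ‖x - y‖)
    (hper : ∀ i x (m : Fin n → ℤ), ρ i (fun j => x j - m j * (2 * π)) = ρ i x) :
    {x : Fin n → ℝ | (∀ i, x i ∈ Set.Ico 0 (2 * π)) ∧ ∀ i, sin (x i - φ i) = ρ i x}.Finite ∧
    {x : Fin n → ℝ | (∀ i, x i ∈ Set.Ico 0 (2 * π)) ∧ ∀ i, sin (x i - φ i) = ρ i x}.ncard
      = 2 ^ n := by
  let G : (Fin n → Bool) → (Fin n → ℝ) → (Fin n → ℝ) :=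
    fun s x i => φ i + arcsinBranch (s i) (ρ i x)
  have hG : ∀ s, ContractingWith (1 / 2) (G s) := fun s => by
    refine ⟨by rw [← NNReal.coe_lt_coe]; norm_num, LipschitzWith.of_dist_le_mul fun x y => ?_⟩
    rw [dist_pi_le_iff (by positivity)]
    intro i
    rw [Real.dist_eq, add_sub_add_left_eq_sub, dist_eq_norm]
    refine (abs_arcsinBranch_sub_le _ (hρ i x) (hρ i y)).trans ?_
    have := hlip i x y
    push_cast
    linarith
  let X : (Fin n → Bool) → (Fin n → ℝ) := fun s => (hG s).fixedPoint
  have hX : ∀ s i, X s i - φ i = arcsinBranch (s i) (ρ i (X s)) := fun s i => by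
    have h : G s (X s) = X s := (hG s).fixedPoint_isFixedPt
    conv_lhs => rw [← h]
    simp [G]
  have hp : (0 : ℝ) < 2 * π := two_pi_pos
  let M : (Fin n → Bool) → (Fin n → ℤ) := fun s i => toIcoDiv hp 0 (X s i)
  let Y : (Fin n → Bool) → (Fin n → ℝ) := fun s i => toIcoMod hp 0 (X s i)
  have hY : ∀ s, Y s = fun i => X s i - M s i * (2 * π) := fun s => by
    funext i
    rw [← zsmul_eq_mul]
    rfl
  have hYi : ∀ s i, Y s i - φ i = arcsinBranch (s i) (ρ i (X s)) - M s i * (2 * π) := fun s i => by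
    rw [hY, ← hX]
    ring
  have hrange : {x : Fin n → ℝ | (∀ i, x i ∈ Set.Ico 0 (2 * π)) ∧ ∀ i, sin (x i - φ i) = ρ i x}
      = Set.range Y := by
    ext x
    constructor
    · rintro ⟨hx, hsin⟩
      choose s m hsm using fun i => exists_eq_arcsinBranch (hρ i x) (hsin i)
      refine ⟨s, ?_⟩
      have hfix : (fun j => x j - m j * (2 * π)) = X s := by
        refine (hG s).fixedPoint_unique ?_
        funext i
        change φ i + arcsinBranch (s i) (ρ i _) = _
        rw [hper, ← hsm]
        ring
      funext i
      change toIcoMod hp 0 (X s i) = x i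
      rw [← hfix]
      simp only [← zsmul_eq_mul]
      rw [toIcoMod_sub_zsmul, toIcoMod_eq_self]
      simpa using hx i
    · rintro ⟨s, rfl⟩
      refine ⟨fun i => by simpa using toIcoMod_mem_Ico hp 0 (X s i), fun i => ?_⟩
      rw [hYi, Real.sin_sub_int_mul_two_pi, sin_arcsinBranch _ (hρ _ _), hY, hper]
  have hinj : Function.Injective Y := fun s s' h => by
    funext i
    have h1 : ∀ s, 0 < cos (Y s i - φ i) ↔ s i = false := fun s => by
      rw [hYi, Real.cos_sub_int_mul_two_pi, cos_arcsinBranch_pos_iff _ (hρ _ _)]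
    have h2 : s i = false ↔ s' i = false := by rw [← h1, ← h1, h]
    cases hs : s i <;> cases hs' : s' i <;> simp_all
  rw [hrange]
  exact ⟨Set.finite_range Y, by rw [Set.ncard_range_of_injective hinj]; simp⟩

/-- The trigonometric series `∑' k, (c k * cos (k·x) + d k * sin (k·x))`. -/
noncomputable def trigSeries {n : ℕ} (c d : (Fin n → ℤ) → ℝ) (x : Fin n → ℝ) : ℝ :=
  ∑' k : Fin n → ℤ, (c k * cos (∑ i, (k i : ℝ) * x i) + d k * sin (∑ i, (k i : ℝ) * x i))

/-- The `ℓ¹`-norm of a frequency vector. -/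
noncomputable def freqNorm {n : ℕ} (k : Fin n → ℤ) : ℝ := ∑ i, |(k i : ℝ)|

theorem freqNorm_nonneg {n : ℕ} (k : Fin n → ℤ) : 0 ≤ freqNorm k :=
  Finset.sum_nonneg fun _ _ => abs_nonneg _

theorem abs_le_freqNorm {n : ℕ} (k : Fin n → ℤ) (i : Fin n) : |(k i : ℝ)| ≤ freqNorm k :=
  Finset.single_le_sum (f := fun i => |(k i : ℝ)|) (fun _ _ => abs_nonneg _) (Finset.mem_univ i)

theorem abs_mul_cos_add_mul_sin_le (a b y : ℝ) : |a * cos y + b * sin y| ≤ |a| + |b| := by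
  refine (abs_add_le _ _).trans ?_
  rw [abs_mul, abs_mul]
  exact add_le_add (mul_le_of_le_one_right (abs_nonneg _) (abs_cos_le_one _))
    (mul_le_of_le_one_right (abs_nonneg _) (abs_sin_le_one _))

theorem abs_trigSeries_le {n : ℕ} {c d g : (Fin n → ℤ) → ℝ} (hg : Summable g)
    (hcd : ∀ k, |c k| + |d k| ≤ g k) (x : Fin n → ℝ) : |trigSeries c d x| ≤ ∑' k, g k :=
  tsum_of_norm_bounded (f := fun k : Fin n → ℤ =>
    (c k * cos (∑ i, (k i : ℝ) * x i) + d k * sin (∑ i, (k i : ℝ) * x i)))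
    hg.hasSum fun k => (abs_mul_cos_add_mul_sin_le _ _ _).trans (hcd k)

theorem summable_trigSeries {n : ℕ} {c d g : (Fin n → ℤ) → ℝ} (hg : Summable g)
    (hcd : ∀ k, |c k| + |d k| ≤ g k) (x : Fin n → ℝ) : Summable fun k : Fin n → ℤ =>
      (c k * cos (∑ i, (k i : ℝ) * x i) + d k * sin (∑ i, (k i : ℝ) * x i)) :=
  .of_norm_bounded hg fun k => (abs_mul_cos_add_mul_sin_le _ _ _).trans (hcd k)

theorem trigSeries_sub_int_mul_two_pi {n : ℕ} (c d : (Fin n → ℤ) → ℝ) (x : Fin n → ℝ) (m : Fin n → ℤ) :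
    trigSeries c d (fun j => x j - m j * (2 * π)) = trigSeries c d x := by
  refine tsum_congr fun k => ?_
  have h : ∑ i, (k i : ℝ) * (x i - m i * (2 * π))
      = ∑ i, (k i : ℝ) * x i - (∑ i, k i * m i : ℤ) * (2 * π) := by
    push_cast
    rw [Finset.sum_mul, ← Finset.sum_sub_distrib]
    exact Finset.sum_congr rfl fun i _ => by ring
  rw [h, Real.cos_sub_int_mul_two_pi, Real.sin_sub_int_mul_two_pi]

/-- Termwise differentiation of a trigonometric series. -/
theorem trigSeries_differentiable {n : ℕ} {c d g : (Fin n → ℤ) → ℝ} (hg : Summable g)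
    (hcd : ∀ k, |c k| + |d k| ≤ g k) (hcd' : ∀ k, freqNorm k * (|c k| + |d k|) ≤ g k) :
    Differentiable ℝ (trigSeries c d) ∧
    (∀ x, ‖fderiv ℝ (trigSeries c d) x‖ ≤ ∑' k, g k) ∧
    ∀ x j, fderiv ℝ (trigSeries c d) x (Pi.single j 1) =
      trigSeries (fun k => k j * d k) (fun k => -(k j * c k)) x := by
  let ℓ : (Fin n → ℤ) → (Fin n → ℝ) →L[ℝ] ℝ := fun k =>
    ∑ i, (k i : ℝ) • ContinuousLinearMap.proj (R := ℝ) (φ := fun _ : Fin n => ℝ) i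
  have hℓ : ∀ k x, ℓ k x = ∑ i, (k i : ℝ) * x i := fun k x => by
    simp [ℓ]
  have hℓn : ∀ k, ‖ℓ k‖ ≤ freqNorm k := fun k => by
    refine ContinuousLinearMap.opNorm_le_bound _ (freqNorm_nonneg k) fun x => ?_
    rw [hℓ, freqNorm, Finset.sum_mul]
    refine (norm_sum_le _ _).trans (Finset.sum_le_sum fun i _ => ?_)
    rw [norm_mul, Real.norm_eq_abs]
    exact mul_le_mul_of_nonneg_left (norm_le_pi_norm x i) (abs_nonneg _)
  let f' : (Fin n → ℤ) → (Fin n → ℝ) → (Fin n → ℝ) →L[ℝ] ℝ := fun k x =>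
    (d k * cos (ℓ k x) + -c k * sin (ℓ k x)) • ℓ k
  have hf' : ∀ k x, ‖f' k x‖ ≤ g k := fun k x => by
    rw [norm_smul, mul_comm]
    refine le_trans ?_ (hcd' k)
    refine mul_le_mul (hℓn k) ?_ (norm_nonneg _) (freqNorm_nonneg k)
    refine (abs_mul_cos_add_mul_sin_le _ _ _).trans ?_
    rw [abs_neg, add_comm]
  have hd : ∀ x, HasFDerivAt (trigSeries c d) (∑' k, f' k x) x := by
    refine hasFDerivAt_tsum (x₀ := 0) hg (fun k x => ?_) hf' (summable_trigSeries hg hcd 0)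
    have h1 : HasFDerivAt (fun x : Fin n → ℝ => ∑ i, (k i : ℝ) * x i) (ℓ k) x := by
      simp only [← hℓ]
      exact (ℓ k).hasFDerivAt
    refine ((h1.cos.const_mul (c k)).add (h1.sin.const_mul (d k))).congr_fderiv ?_
    ext v
    simp [f', hℓ]
    ring
  refine ⟨fun x => (hd x).differentiableAt, fun x => ?_, fun x j => ?_⟩
  · rw [(hd x).fderiv]
    exact tsum_of_norm_bounded hg.hasSum fun k => hf' k x
  · rw [(hd x).fderiv]
    have hs : Summable fun k => f' k x := .of_norm_bounded hg fun k => hf' k x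
    have := (ContinuousLinearMap.apply ℝ ℝ (Pi.single j 1 : Fin n → ℝ)).map_tsum hs
    simp only [ContinuousLinearMap.apply_apply] at this
    rw [this]
    refine tsum_congr fun k => ?_
    simp only [f', smul_apply, smul_eq_mul, hℓ, Pi.single_apply]
    simp
    ring

theorem summable_pi_prod {n : ℕ} {w : ℤ → ℝ} (hw : Summable w) (h0 : ∀ m, 0 ≤ w m) :
    Summable fun k : Fin n → ℤ => ∏ i, w (k i) := by
  classical
  refine summable_of_sum_le (c := ∏ _i : Fin n, ∑' m, w m)
    (fun k => Finset.prod_nonneg fun i _ => h0 _) fun u => ?_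
  let t : Fin n → Finset ℤ := fun i => u.image fun k => k i
  calc ∑ k ∈ u, ∏ i, w (k i) ≤ ∑ k ∈ Fintype.piFinset t, ∏ i, w (k i) := by
        refine Finset.sum_le_sum_of_subset_of_nonneg (fun k hk => ?_)
          fun k _ _ => Finset.prod_nonneg fun i _ => h0 _
        exact Fintype.mem_piFinset.2 fun i => Finset.mem_image_of_mem _ hk
    _ = ∏ i, ∑ m ∈ t i, w m := (Finset.prod_univ_sum t fun _ => w).symm
    _ ≤ ∏ _i : Fin n, ∑' m, w m := Finset.prod_le_prod
        (fun i _ => Finset.sum_nonneg fun m _ => h0 m)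
        fun i _ => hw.sum_le_tsum _ fun m _ => h0 m

theorem summable_exp_freqNorm_sub_sq (n : ℕ) :
    Summable fun k : Fin n → ℤ => exp (2 * freqNorm k - ∑ i, (k i : ℝ) ^ 2) := by
  have h1 : Summable fun m : ℤ => exp (-|(m : ℝ)|) := by
    refine .of_nat_of_neg ?_ ?_ <;> simpa using Real.summable_exp_neg_nat
  have hw : Summable fun m : ℤ => exp (2 * |(m : ℝ)| - (m : ℝ) ^ 2) := by
    refine .of_nonneg_of_le (fun _ => (exp_pos _).le) (fun m => ?_) (h1.mul_left (exp 3))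
    rw [← exp_add, exp_le_exp]
    nlinarith [sq_abs (m : ℝ), sq_nonneg (|(m : ℝ)| - 3 / 2)]
  refine (summable_pi_prod hw fun _ => (exp_pos _).le).congr fun k => ?_
  rw [← exp_sum, freqNorm, Finset.mul_sum, Finset.sum_sub_distrib]

theorem freqNorm_bounds {n : ℕ} (k : Fin n → ℤ) :
    1 ≤ exp (2 * freqNorm k) ∧ freqNorm k ≤ exp (2 * freqNorm k) ∧
      freqNorm k * freqNorm k ≤ exp (2 * freqNorm k) := by
  have h0 := freqNorm_nonneg k
  have h1 := add_one_le_exp (freqNorm k)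
  have h2 : exp (2 * freqNorm k) = exp (freqNorm k) * exp (freqNorm k) := by
    rw [← exp_add]
    ring_nf
  rw [h2]
  refine ⟨?_, ?_, ?_⟩ <;> nlinarith

theorem eq_single_or_eq_neg_single {n : ℕ} {k : Fin n → ℤ} {j : Fin n}
    (hk : ∑ i, (k i : ℝ) ^ 2 < 2) (hj : k j ≠ 0) :
    k = Pi.single j 1 ∨ k = -Pi.single j 1 := by
  have hk' : ∑ i, k i ^ 2 < 2 := by exact_mod_cast hk
  have h1 : 0 < k j ^ 2 := by positivity
  have hne : ∀ i, i ≠ j → k i = 0 := fun i hi => by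
    have h2 : ∑ l ∈ ({i, j} : Finset (Fin n)), k l ^ 2 ≤ ∑ l, k l ^ 2 :=
      Finset.sum_le_sum_of_subset_of_nonneg (Finset.subset_univ _) fun _ _ _ => sq_nonneg _
    rw [Finset.sum_pair hi] at h2
    exact pow_eq_zero_iff two_ne_zero |>.1 (le_antisymm (by linarith) (sq_nonneg _))
  have h3 : k j ^ 2 ≤ ∑ l, k l ^ 2 :=
    Finset.single_le_sum (f := fun l => k l ^ 2) (fun _ _ => sq_nonneg _) (Finset.mem_univ j)
  have h4 : k j ^ 2 = 1 := by linarith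
  rcases sq_eq_one_iff.1 h4 with h | h
  · left
    funext i
    by_cases hi : i = j
    · subst hi; simpa using h
    · simp [hne i hi, hi]
  · right
    funext i
    by_cases hi : i = j
    · subst hi; simpa using h
    · simp [hne i hi, hi]

/-- The heat multiplier on modes of energy at least `2`, normalised by the decay of the first
eigenspace. -/
noncomputable def tailMultiplier {n : ℕ} (t : ℝ) (k : Fin n → ℤ) : ℝ :=
  if 2 ≤ ∑ i, (k i : ℝ) ^ 2 then exp (-((∑ i, (k i : ℝ) ^ 2) - 1) * t) else 0

theorem tailMultiplier_nonneg {n : ℕ} (t : ℝ) (k : Fin n → ℤ) : 0 ≤ tailMultiplier t k := by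
  unfold tailMultiplier
  split_ifs
  exacts [(exp_pos _).le, le_rfl]

theorem tailMultiplier_le {n : ℕ} {t : ℝ} (ht : 1 ≤ t) (k : Fin n → ℤ) :
    tailMultiplier t k ≤ exp (2 - t) * exp (-∑ i, (k i : ℝ) ^ 2) := by
  unfold tailMultiplier
  split_ifs with h
  · rw [← exp_add, exp_le_exp]
    nlinarith
  · positivity

/-- The remainder of the `j`-th partial derivative of the heat flow after removing the first
eigenspace and normalising. -/
noncomputable def tailDeriv {n : ℕ} (c d : (Fin n → ℤ) → ℝ) (t : ℝ) (j : Fin n) :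
    (Fin n → ℝ) → ℝ :=
  trigSeries (fun k => k j * (tailMultiplier t k * d k))
    (fun k => -(k j * (tailMultiplier t k * c k)))

theorem partial_coeff_bounds {n : ℕ} {c d : (Fin n → ℤ) → ℝ} {M C : ℝ}
    {μ : (Fin n → ℤ) → ℝ} (hM : ∀ k, |c k| + |d k| ≤ M)
    (hμ0 : ∀ k, 0 ≤ μ k) (hμ : ∀ k, μ k ≤ C * exp (-∑ i, (k i : ℝ) ^ 2)) (k : Fin n → ℤ) :
    let g := C * M * exp (2 * freqNorm k - ∑ i, (k i : ℝ) ^ 2)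
    (|μ k * c k| + |μ k * d k| ≤ g ∧ freqNorm k * (|μ k * c k| + |μ k * d k|) ≤ g) ∧
    ∀ j, |k j * (μ k * d k)| + |-(k j * (μ k * c k))| ≤ g ∧
      freqNorm k * (|k j * (μ k * d k)| + |-(k j * (μ k * c k))|) ≤ g := by
  intro g
  have hg : g = C * exp (-∑ i, (k i : ℝ) ^ 2) * M * exp (2 * freqNorm k) := by
    simp only [g, sub_eq_add_neg, exp_add]
    ring
  obtain ⟨e1, e2, e3⟩ := freqNorm_bounds k
  have hN := freqNorm_nonneg k
  have hs : 0 ≤ |c k| + |d k| := by positivity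
  have hB : μ k * (|c k| + |d k|) ≤ C * exp (-∑ i, (k i : ℝ) ^ 2) * M :=
    mul_le_mul (hμ k) (hM k) hs ((hμ0 k).trans (hμ k))
  have hB0 : 0 ≤ μ k * (|c k| + |d k|) := mul_nonneg (hμ0 k) hs
  have main : ∀ y, 0 ≤ y → y ≤ exp (2 * freqNorm k) → y * (μ k * (|c k| + |d k|)) ≤ g :=
    fun y hy hy' => by
      rw [hg, mul_comm y]
      exact mul_le_mul hB hy' hy (hB0.trans hB)
  have h1 : |μ k * c k| + |μ k * d k| = μ k * (|c k| + |d k|) := by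
    rw [abs_mul, abs_mul, abs_of_nonneg (hμ0 k)]
    ring
  have h2 : ∀ j, |k j * (μ k * d k)| + |-(k j * (μ k * c k))|
      = |(k j : ℝ)| * (μ k * (|c k| + |d k|)) := fun j => by
    rw [abs_neg, abs_mul, abs_mul, abs_mul, abs_mul, abs_of_nonneg (hμ0 k)]
    ring
  refine ⟨⟨?_, ?_⟩, fun j => ⟨?_, ?_⟩⟩
  · simpa only [h1, one_mul] using main 1 zero_le_one e1
  · simpa only [h1] using main _ hN e2
  · rw [h2]
    exact main _ (abs_nonneg _) ((abs_le_freqNorm k j).trans e2)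
  · rw [h2, ← mul_assoc]
    exact main _ (by positivity)
      ((mul_le_mul_of_nonneg_left (abs_le_freqNorm k j) hN).trans e3)

theorem trigSeries_partial_eq {n : ℕ} {c d g : (Fin n → ℤ) → ℝ} {t : ℝ} (j : Fin n)
    (hg : Summable g) (x : Fin n → ℝ)
    (h1 : ∀ k : Fin n → ℤ, |k j * (exp (-(∑ i, (k i : ℝ) ^ 2) * t) * d k)|
      + |-(k j * (exp (-(∑ i, (k i : ℝ) ^ 2) * t) * c k))| ≤ g k)
    (h2 : ∀ k : Fin n → ℤ, |k j * (tailMultiplier t k * d k)|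
      + |-(k j * (tailMultiplier t k * c k))| ≤ g k) :
    trigSeries (fun k => k j * (exp (-(∑ i, (k i : ℝ) ^ 2) * t) * d k))
      (fun k => -(k j * (exp (-(∑ i, (k i : ℝ) ^ 2) * t) * c k))) x =
    exp (-t) * ((d (Pi.single j 1) - d (-Pi.single j 1)) * cos (x j)
      - (c (Pi.single j 1) + c (-Pi.single j 1)) * sin (x j) + tailDeriv c d t j x) := by
  have hs1 := summable_trigSeries hg h1 x
  have hs2 := (summable_trigSeries hg h2 x).mul_left (exp (-t))
  have hne : (Pi.single j 1 : Fin n → ℤ) ≠ -Pi.single j 1 := fun h => by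
    have := congrFun h j
    simp at this
  have key := hs1.tsum_sub hs2
  rw [tsum_mul_left] at key
  rw [mul_add, ← sub_eq_iff_eq_add, tailDeriv, trigSeries, trigSeries, ← key,
    tsum_eq_sum (s := {Pi.single j 1, -Pi.single j 1}), Finset.sum_pair hne]
  · have hq : ∀ i : Fin n, ((Pi.single j 1 : Fin n → ℤ) i : ℝ) = if i = j then 1 else 0 :=
      fun i => by simp [Pi.single_apply]
    have hq1 : ∑ i, ((Pi.single j 1 : Fin n → ℤ) i : ℝ) ^ 2 = 1 := by simp [hq]
    have hq2 : ∑ i, ((-Pi.single j 1 : Fin n → ℤ) i : ℝ) ^ 2 = 1 := by simp [hq]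
    have hx1 : ∑ i, ((Pi.single j 1 : Fin n → ℤ) i : ℝ) * x i = x j := by simp [hq]
    have hx2 : ∑ i, ((-Pi.single j 1 : Fin n → ℤ) i : ℝ) * x i = -x j := by simp [hq]
    simp only [tailMultiplier, hq1, hq2, hx1, hx2]
    norm_num
    ring
  · intro k hk
    by_cases hj : k j = 0
    · simp [hj]
    by_cases h : 2 ≤ ∑ i, (k i : ℝ) ^ 2
    · have he : exp (-(∑ i, (k i : ℝ) ^ 2) * t) = exp (-t) * tailMultiplier t k := by
        rw [tailMultiplier, if_pos h, ← exp_add]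
        ring_nf
      rw [he]
      ring
    · rcases eq_single_or_eq_neg_single (not_le.1 h) hj with rfl | rfl <;> simp at hk

theorem exists_phase (a b : ℝ) (h : a ^ 2 + b ^ 2 ≠ 0) :
    ∃ A φ : ℝ, 0 < A ∧ ∀ y, b * cos y - a * sin y = -A * sin (y - φ) := by
  let z : ℂ := ⟨a, b⟩
  have hz : z ≠ 0 := fun hz => h (by
    have h1 : a = 0 := congrArg Complex.re hz
    have h2 : b = 0 := congrArg Complex.im hz
    simp [h1, h2])
  refine ⟨‖z‖, z.arg, norm_pos_iff.2 hz, fun y => ?_⟩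
  have h1 : ‖z‖ * cos z.arg = a := Complex.norm_mul_cos_arg z
  have h2 : ‖z‖ * sin z.arg = b := Complex.norm_mul_sin_arg z
  rw [sin_sub, ← h1, ← h2]
  ring

/-- For square-summable Fourier data `(c, d)` on `ℤⁿ`, the heat flow
`f t x = ∑' k, exp (-|k|² t) * (c k * cos (k·x) + d k * sin (k·x))` is, for all
sufficiently large `t`, a function with exactly `2 ^ n` critical points in `[0, 2π)ⁿ`,
all of them nondegenerate, provided the first-mode coefficients
`a i = c eᵢ + c (-eᵢ)`, `b i = d eᵢ - d (-eᵢ)` satisfy `a i ^ 2 + b i ^ 2 ≠ 0` for all `i`. -/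
theorem stmt_3 (n : ℕ) (hn : 1 ≤ n) (c d : (Fin n → ℤ) → ℝ)
    (hsq : Summable fun k : Fin n → ℤ => c k ^ 2 + d k ^ 2)
    (f : ℝ → (Fin n → ℝ) → ℝ)
    (hf : ∀ (t : ℝ) (x : Fin n → ℝ), f t x =
      ∑' k : Fin n → ℤ,
        Real.exp (-(∑ i, ((k i : ℝ)) ^ 2) * t) *
          (c k * Real.cos (∑ i, (k i : ℝ) * x i) + d k * Real.sin (∑ i, (k i : ℝ) * x i)))
    (a b : Fin n → ℝ)
    (ha : ∀ i, a i = c (Pi.single i 1) + c (-Pi.single i 1))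
    (hb : ∀ i, b i = d (Pi.single i 1) - d (-Pi.single i 1))
    (hab : ∀ i, a i ^ 2 + b i ^ 2 ≠ 0) :
    ∃ T > (0 : ℝ), ∀ t ≥ T,
      ({x : Fin n → ℝ | (∀ i, x i ∈ Set.Ico 0 (2 * Real.pi)) ∧ fderiv ℝ (f t) x = 0}.Finite ∧
       {x : Fin n → ℝ | (∀ i, x i ∈ Set.Ico 0 (2 * Real.pi)) ∧ fderiv ℝ (f t) x = 0}.ncard
         = 2 ^ n) ∧
      ∀ x : Fin n → ℝ, fderiv ℝ (f t) x = 0 →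
        (Matrix.of fun i j : Fin n =>
          fderiv ℝ (fun y => fderiv ℝ (f t) y (Pi.single j 1)) x (Pi.single i 1)).det ≠ 0 := by
  obtain ⟨M, hM0, hM⟩ : ∃ M, 0 ≤ M ∧ ∀ k, |c k| + |d k| ≤ M := by
    have h0 : ∀ k, 0 ≤ c k ^ 2 + d k ^ 2 := fun k => by positivity
    refine ⟨1 + ∑' k, (c k ^ 2 + d k ^ 2), add_nonneg zero_le_one (tsum_nonneg h0), fun k => ?_⟩
    have := hsq.le_tsum k fun k _ => h0 k
    nlinarith [sq_nonneg (|c k| - 1), sq_nonneg (|d k| - 1), sq_abs (c k), sq_abs (d k)]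
  choose A φ hA hφ using fun i => exists_phase (a i) (b i) (hab i)
  obtain ⟨δ, hδ, hδA⟩ : ∃ δ > 0, ∀ i, δ ≤ A i := by
    have : Nonempty (Fin n) := ⟨⟨0, hn⟩⟩
    obtain ⟨i, hi⟩ := Finite.exists_min A
    exact ⟨A i, hA i, hi⟩
  let w : (Fin n → ℤ) → ℝ := fun k => exp (2 * freqNorm k - ∑ i, (k i : ℝ) ^ 2)
  have hw : Summable w := summable_exp_freqNorm_sub_sq n
  let ε : ℝ → ℝ := fun t => ∑' k, exp (2 - t) * M * w k
  have hε : Filter.Tendsto ε Filter.atTop (nhds 0) := by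
    have h1 : Filter.Tendsto (fun t : ℝ => exp (2 - t)) Filter.atTop (nhds 0) :=
      tendsto_exp_atBot.comp (Filter.tendsto_atBot_add_const_left _ 2 Filter.tendsto_neg_atTop_atBot)
    have h2 := h1.mul_const (M * ∑' k, w k)
    rw [zero_mul] at h2
    refine h2.congr fun t => ?_
    simp only [ε, tsum_mul_left]
    ring
  obtain ⟨T, hT⟩ := Filter.eventually_atTop.1
    (hε.eventually_lt_const (show 0 < δ / (4 * (n + 1)) by positivity))
  refine ⟨max T 1, by positivity, fun t ht => ?_⟩
  have ht1 : 1 ≤ t := (le_max_right _ _).trans ht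
  have hεt : 4 * (n + 1) * ε t < δ := by
    have := hT t ((le_max_left _ _).trans ht)
    rwa [lt_div_iff₀' (by positivity)] at this
  have hε0 : 0 ≤ ε t := tsum_nonneg fun k => by positivity
  have hε4 : ∀ i, ε t ≤ 1 / 4 * A i := fun i => by
    have : 0 ≤ n * ε t := by positivity
    linarith [hδA i]
  have bE := partial_coeff_bounds (C := 1) hM
    (fun k => (exp_pos (-(∑ i, (k i : ℝ) ^ 2) * t)).le) fun k => by
      have : 0 ≤ ∑ i, (k i : ℝ) ^ 2 := by positivity
      rw [one_mul, exp_le_exp]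
      nlinarith
  have bτ := partial_coeff_bounds hM (tailMultiplier_nonneg t) (tailMultiplier_le ht1)
  have hgE : Summable fun k => 1 * M * w k := hw.mul_left _
  have hgτ : Summable fun k => exp (2 - t) * M * w k := hw.mul_left _
  let r : Fin n → (Fin n → ℝ) → ℝ := tailDeriv c d t
  have hr : ∀ j x, |r j x| ≤ ε t := fun j x =>
    abs_trigSeries_le hgτ (fun k => ((bτ k).2 j).1) x
  have hrd := fun j => trigSeries_differentiable hgτ
    (fun k => ((bτ k).2 j).1) (fun k => ((bτ k).2 j).2)
  have hf1 : ∀ x j, fderiv ℝ (f t) x (Pi.single j 1)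
      = exp (-t) * (-A j * sin (x j - φ j) + r j x) := fun x j => by
    have hft : f t = trigSeries (fun k => exp (-(∑ i, (k i : ℝ) ^ 2) * t) * c k)
        (fun k => exp (-(∑ i, (k i : ℝ) ^ 2) * t) * d k) := by
      funext x
      rw [hf, trigSeries]
      exact tsum_congr fun k => by ring
    rw [hft, (trigSeries_differentiable hgE (fun k => (bE k).1.1) (fun k => (bE k).1.2)).2.2,
      trigSeries_partial_eq j (hgE.add hgτ) x
        (fun k => ((bE k).2 j).1.trans (le_add_of_nonneg_right (by positivity)))
        (fun k => ((bτ k).2 j).1.trans (le_add_of_nonneg_left (by positivity))),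
      ← hφ, ha, hb]
  have hcrit : ∀ x, fderiv ℝ (f t) x = 0 ↔ ∀ i, sin (x i - φ i) = r i x / A i := fun x => by
    have h1 : fderiv ℝ (f t) x = 0 ↔ ∀ i, fderiv ℝ (f t) x (Pi.single i 1) = 0 := by
      refine ⟨fun h i => by simp [h], fun h => ?_⟩
      refine ContinuousLinearMap.coe_injective ((Pi.basisFun ℝ (Fin n)).ext fun i => ?_)
      simpa using h i
    rw [h1]
    refine forall_congr' fun i => ?_
    rw [hf1, mul_eq_zero_iff_left (exp_pos _).ne', eq_div_iff (hA i).ne']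
    constructor <;> intro h <;> linarith
  have hρ : ∀ i x, |r i x / A i| ≤ 1 / 2 := fun i x => by
    rw [abs_div, abs_of_pos (hA i), div_le_iff₀ (hA i)]
    linarith [hr i x, hε4 i, hA i]
  constructor
  · simp only [hcrit]
    refine ncard_sin_sub_eq_perturbation φ (fun i x => r i x / A i) hρ (fun i x y => ?_)
      fun i x m => ?_
    · have h1 := Convex.norm_image_sub_le_of_norm_fderiv_le (𝕜 := ℝ) (f := r i) (C := ε t)
        (fun z _ => (hrd i).1 z) (fun z _ => (hrd i).2.1 z) convex_univ
        (Set.mem_univ y) (Set.mem_univ x)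
      rw [← sub_div, abs_div, abs_of_pos (hA i), div_le_iff₀ (hA i)]
      refine h1.trans ((mul_le_mul_of_nonneg_right (hε4 i) (norm_nonneg _)).trans_eq (by ring))
    · exact congrArg (· / A i) (trigSeries_sub_int_mul_two_pi _ _ x m)
  · intro x hx
    have hcos : ∀ i, 1 / 2 ≤ |cos (x i - φ i)| := fun i =>
      half_le_abs_cos (by rw [(hcrit x).1 hx i]; exact hρ i x)
    let D : Fin n → Fin n → ℝ := fun i j => fderiv ℝ (r j) x (Pi.single i 1)
    have hD : ∀ i j, |D i j| ≤ ε t := fun i j => by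
      refine ((fderiv ℝ (r j) x).le_opNorm _).trans ?_
      have h1 : ‖(Pi.single i 1 : Fin n → ℝ)‖ = 1 := by rw [Pi.norm_single, norm_one]
      rw [h1, mul_one]
      exact (hrd j).2.1 x
    have hH : ∀ i j, fderiv ℝ (fun y => fderiv ℝ (f t) y (Pi.single j 1)) x (Pi.single i 1)
        = exp (-t) * ((if j = i then -A j * cos (x j - φ j) else 0) + D i j) := fun i j => by
      simp only [hf1]
      have h1 : HasFDerivAt (fun y : Fin n → ℝ => y j - φ j)
          (ContinuousLinearMap.proj (R := ℝ) (φ := fun _ : Fin n => ℝ) j) x :=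
        (hasFDerivAt_apply j x).sub_const _
      have h2 := ((h1.sin.const_mul (-A j)).add ((hrd j).1 x).hasFDerivAt).const_mul (exp (-t))
      have h3 := congrArg (fun L => L (Pi.single i (1 : ℝ))) h2.fderiv
      refine h3.trans ?_
      by_cases hij : j = i
      · subst hij
        simp [D, r, tailDeriv, mul_add]
      · simp [D, r, tailDeriv, hij]
    refine det_ne_zero_of_sum_row_lt_diag fun i => ?_
    simp only [Matrix.of_apply, hH, norm_mul, Real.norm_eq_abs, if_true, abs_exp]
    rw [← Finset.mul_sum]
    refine mul_lt_mul_of_pos_left ?_ (exp_pos _)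
    calc ∑ j ∈ Finset.univ.erase i, |(if j = i then -A j * cos (x j - φ j) else 0) + D i j|
        ≤ ∑ j ∈ Finset.univ.erase i, ε t := Finset.sum_le_sum fun j hj => by
          rw [if_neg (Finset.ne_of_mem_erase hj), zero_add]
          exact hD i j
      _ ≤ n * ε t := by
          rw [Finset.sum_const, nsmul_eq_mul]
          refine mul_le_mul_of_nonneg_right ?_ hε0
          exact_mod_cast (Finset.card_erase_le).trans_eq (by simp)
      _ < A i * |cos (x i - φ i)| - |D i i| := by
          nlinarith [hδA i, hcos i, hA i, hD i i]
      _ ≤ |-A i * cos (x i - φ i) + D i i| := by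
          have h1 := abs_sub_abs_le_abs_sub (-A i * cos (x i - φ i)) (-D i i)
          rw [abs_mul, abs_neg, abs_neg, abs_of_pos (hA i), sub_neg_eq_add] at h1
          exact h1
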